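/- For a positive integer n, there exist two partitions A_1,...,A_p and B_1,...,B_q of {1,...,n} having the Knowlton–Graham property if and only if n is not equal to 2, 5, or 9. -/

import Mathlib

open Finset

/-- Two partitions of `{1,...,n}` (modeled as `Fin n`) have the Knowlton–Graham
property if for every pair `(j,k)`, at most one element lies both in an `A`-block
of cardinality `j` and in a `B`-block of cardinality `k`. -/
def KnowltonGraham {n : ℕ} (P Q : Finpartition (Finset.univ : Finset (Fin n))) : Prop :=
  ∀ j k : ℕ, ({x : Fin n |
      (∃ A ∈ P.parts, x ∈ A ∧ A.card = j) ∧
      (∃ B ∈ Q.parts, x ∈ B ∧ B.card = k)} : Set (Fin n)).Subsingleton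

lemma kg_split {α : Type*} [DecidableEq α] (j q : ℕ) : ∀ (s : Finset α), s.card = j * q →
    ∃ h : α → ℕ, ∀ x ∈ s, (s.filter (fun y => h y = h x)).card = j := by
  induction q with
  | zero =>
    intro s hs
    refine ⟨fun _ => 0, fun x hx => ?_⟩
    have : s = ∅ := by simpa using hs
    simp [this] at hx
  | succ q ih =>
    intro s hs
    obtain ⟨t, hts, htc⟩ := Finset.exists_subset_card_eq (s := s) (n := j) (by rw [hs]; nlinarith)
    obtain ⟨h, hh⟩ := ih (s \ t) (by
      rw [Finset.card_sdiff_of_subset hts, hs, htc, Nat.mul_succ]; omega)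
    refine ⟨fun x => if x ∈ t then 0 else h x + 1, fun x hx => ?_⟩
    by_cases hxt : x ∈ t
    · rw [← htc]
      congr 1
      ext y
      simp only [Finset.mem_filter, hxt, if_true]
      by_cases hyt : y ∈ t
      · simp [hyt, hts hyt]
      · simp [hyt]
    · rw [← hh x (by simp [hx, hxt])]
      congr 1
      ext y
      simp only [Finset.mem_filter, hxt, if_false, Finset.mem_sdiff]
      by_cases hyt : y ∈ t
      · simp [hyt]
      · simp [hyt]

lemma kg_part {n : ℕ} (f : Fin n → ℕ)
    (hf : ∀ j, j ∣ (univ.filter (fun x => f x = j)).card) :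
    ∃ P : Finpartition (Finset.univ : Finset (Fin n)), ∀ A ∈ P.parts, ∀ x ∈ A, A.card = f x := by
  have : ∀ j, ∃ h : Fin n → ℕ, ∀ x ∈ univ.filter (fun x => f x = j),
      ((univ.filter (fun x => f x = j)).filter (fun y => h y = h x)).card = j := by
    intro j
    obtain ⟨q, hq⟩ := hf j
    exact kg_split j q _ hq
  choose h hh using this
  let g : Fin n → ℕ × ℕ := fun x => (f x, h (f x) x)
  let st : Setoid (Fin n) := Setoid.ker g
  have : DecidableRel st.r := fun a b => Classical.dec _
  refine ⟨Finpartition.ofSetoid st, fun A hA x hx => ?_⟩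
  have hAx : A = (Finpartition.ofSetoid st).part x :=
    ((Finpartition.ofSetoid st).part_eq_of_mem hA hx).symm
  rw [hAx]
  conv_rhs => rw [← hh (f x) x (by simp)]
  congr 1
  ext y
  rw [Finpartition.mem_part_ofSetoid_iff_rel]
  simp only [Finset.mem_filter, Finset.mem_univ, true_and]
  change g x = g y ↔ _
  simp only [g, Prod.mk.injEq]
  constructor
  · rintro ⟨h1, h2⟩
    rw [← h1] at h2
    exact ⟨h1.symm, h2.symm⟩
  · rintro ⟨h1, h2⟩
    rw [h1]
    exact ⟨rfl, h2.symm⟩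

lemma kg_exists (n m : ℕ) (p : ℕ → ℕ → Prop) [∀ a b, Decidable (p a b)]
    (hr : ∀ j ∈ Icc 1 m, j ∣ ((Icc 1 m).filter (fun k => p j k)).card)
    (hc : ∀ k ∈ Icc 1 m, k ∣ ((Icc 1 m).filter (fun j => p j k)).card)
    (hn : n = ∑ j ∈ Icc 1 m, ((Icc 1 m).filter (fun k => p j k)).card) :
    ∃ P Q : Finpartition (Finset.univ : Finset (Fin n)), KnowltonGraham P Q := by
  let S : Finset (ℕ × ℕ) := (Icc 1 m ×ˢ Icc 1 m).filter (fun a => p a.1 a.2)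
  have hrow : ∀ j ∈ Icc 1 m, (S.filter (fun a => a.1 = j)).card
      = ((Icc 1 m).filter (fun k => p j k)).card := by
    intro j hj
    refine Finset.card_bij' (fun a _ => a.2) (fun k _ => (j, k)) ?_ ?_ ?_ ?_
    · rintro ⟨a, b⟩ h
      simp only [S, mem_filter, mem_product] at h ⊢
      obtain ⟨⟨⟨h1, h2⟩, h3⟩, rfl⟩ := h
      exact ⟨h2, h3⟩
    · intro k h
      simp only [S, mem_filter, mem_product] at h ⊢
      exact ⟨⟨⟨hj, h.1⟩, h.2⟩, trivial⟩
    · rintro ⟨a, b⟩ h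
      simp only [mem_filter] at h
      simp [h.2]
    · intro k h
      rfl
  have hcol : ∀ k ∈ Icc 1 m, (S.filter (fun a => a.2 = k)).card
      = ((Icc 1 m).filter (fun j => p j k)).card := by
    intro j hj
    refine Finset.card_bij' (fun a _ => a.1) (fun k _ => (k, j)) ?_ ?_ ?_ ?_
    · rintro ⟨a, b⟩ h
      simp only [S, mem_filter, mem_product] at h ⊢
      obtain ⟨⟨⟨h1, h2⟩, h3⟩, rfl⟩ := h
      exact ⟨h1, h3⟩
    · intro k h
      simp only [S, mem_filter, mem_product] at h ⊢
      exact ⟨⟨⟨h.1, hj⟩, h.2⟩, trivial⟩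
    · rintro ⟨a, b⟩ h
      simp only [mem_filter] at h
      simp [h.2]
    · intro k h
      rfl
  have hS : S.card = n := by
    rw [hn, Finset.card_eq_sum_card_fiberwise (f := Prod.fst) (t := Icc 1 m)]
    · exact Finset.sum_congr rfl hrow
    · intro a ha
      have ha' : a ∈ S := ha
      simp only [S, mem_filter, mem_product] at ha'
      exact ha'.1.1
  let e : Fin n ≃ S := (S.equivFinOfCardEq hS).symm
  have key : ∀ (π : ℕ × ℕ → ℕ), (∀ a ∈ S, π a ∈ Icc 1 m) →
      (∀ j ∈ Icc 1 m, j ∣ (S.filter (fun a => π a = j)).card) →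
      ∀ j, j ∣ (univ.filter (fun x : Fin n => π (e x) = j)).card := by
    intro π h1 h2 j
    have : (univ.filter (fun x : Fin n => π (e x) = j)).card
        = (S.filter (fun a => π a = j)).card := by
      refine Finset.card_bij (fun x _ => (e x : ℕ × ℕ)) ?_ ?_ ?_
      · intro x hx
        simp only [mem_filter, mem_univ, true_and] at hx ⊢
        exact ⟨(e x).2, hx⟩
      · intro x _ y _ hxy
        exact e.injective (Subtype.ext hxy)
      · intro b hb
        rw [mem_filter] at hb
        exact ⟨e.symm ⟨b, hb.1⟩, by simp [hb.2], by simp⟩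
    rw [this]
    by_cases hj : j ∈ Icc 1 m
    · exact h2 j hj
    · rw [Finset.filter_false_of_mem]
      · simp
      · rintro a ha rfl
        exact hj (h1 a ha)
  obtain ⟨P, hP⟩ := kg_part (fun x => (e x : ℕ × ℕ).1) (key Prod.fst
    (fun a ha => by simp only [S, mem_filter, mem_product] at ha; exact ha.1.1)
    (fun j hj => by rw [hrow j hj]; exact hr j hj))
  obtain ⟨Q, hQ⟩ := kg_part (fun x => (e x : ℕ × ℕ).2) (key Prod.snd
    (fun a ha => by simp only [S, mem_filter, mem_product] at ha; exact ha.1.2)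
    (fun j hj => by rw [hcol j hj]; exact hc j hj))
  refine ⟨P, Q, ?_⟩
  rintro j k x ⟨⟨A, hA, hxA, hAj⟩, B, hB, hxB, hBk⟩ y ⟨⟨A', hA', hyA, hAj'⟩, B', hB', hyB, hBk'⟩
  apply e.injective
  apply Subtype.ext
  apply Prod.ext
  · have := hP A hA x hxA
    have := hP A' hA' y hyA
    omega
  · have := hQ B hB x hxB
    have := hQ B' hB' y hyB
    omega

lemma kg_sum (m : ℕ) : 2 * ∑ j ∈ Icc 1 m, j = m * (m + 1) := by
  induction m with
  | zero => simp
  | succ m ih => rw [Finset.sum_Icc_succ_top (by omega), mul_add, ih]; ring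

lemma kg_total (m c : ℕ) (F : ℕ → ℕ) (hm : 1 ≤ m) (h1 : F 1 = 1 + c)
    (hF : ∀ j ∈ Icc 2 m, F j = j) : ∑ j ∈ Icc 1 m, F j = ∑ j ∈ Icc 1 m, j + c := by
  have : Icc 1 m = insert 1 (Icc 2 m) := by ext; simp; omega
  rw [this, Finset.sum_insert (by simp), Finset.sum_insert (by simp), h1, Finset.sum_congr rfl hF]
  ring

lemma kg_one (m t : ℕ) (hm : 1 ≤ m) (ht : t < m) :
    ∃ P Q : Finpartition (Finset.univ : Finset (Fin (∑ j ∈ Icc 1 m, j + t))),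
      KnowltonGraham P Q := by
  let p : ℕ → ℕ → Prop := fun j k =>
    (j = 1 ∧ (k ≤ t ∨ k = m)) ∨ (k = 1 ∧ (m + 1 ≤ j + t ∨ j = m)) ∨
    (2 ≤ j ∧ 2 ≤ k ∧ (m + 2 ≤ j + k ∨ (j + k = m + 1 ∧ t < k)))
  have : ∀ a b, Decidable (p a b) := fun a b => by unfold p; infer_instance
  have hrow : ∀ j ∈ Icc 2 m, ((Icc 1 m).filter (fun k => p j k)).card = j := by
    intro j hj
    rw [mem_Icc] at hj
    by_cases h : m + 1 ≤ j + t
    · have : (Icc 1 m).filter (fun k => p j k) = insert 1 (Icc (m + 2 - j) m) := by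
        ext k; simp only [mem_filter, mem_insert, mem_Icc, p, true_and]; omega
      rw [this, card_insert_of_notMem (by simp; omega), Nat.card_Icc]; omega
    · have : (Icc 1 m).filter (fun k => p j k) = Icc (m + 1 - j) m := by
        ext k; simp only [mem_filter, mem_Icc, p, true_and]; omega
      rw [this, Nat.card_Icc]; omega
  have hcol : ∀ k ∈ Icc 2 m, ((Icc 1 m).filter (fun j => p j k)).card = k := by
    intro k hk
    rw [mem_Icc] at hk
    by_cases h : k ≤ t
    · have : (Icc 1 m).filter (fun j => p j k) = insert 1 (Icc (m + 2 - k) m) := by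
        ext j; simp only [mem_filter, mem_insert, mem_Icc, p, true_and]; omega
      rw [this, card_insert_of_notMem (by simp; omega), Nat.card_Icc]; omega
    · have : (Icc 1 m).filter (fun j => p j k) = Icc (m + 1 - k) m := by
        ext j; simp only [mem_filter, mem_Icc, p, true_and]; omega
      rw [this, Nat.card_Icc]; omega
  have h1 : ((Icc 1 m).filter (fun k => p 1 k)).card = 1 + t := by
    have : (Icc 1 m).filter (fun k => p 1 k) = insert m (Icc 1 t) := by
      ext k; simp only [mem_filter, mem_insert, mem_Icc, p, true_and]; omega
    rw [this, card_insert_of_notMem (by simp; omega), Nat.card_Icc]; omega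
  refine kg_exists _ m p ?_ ?_ (kg_total m t _ hm h1 hrow).symm
  · intro j hj
    by_cases h : j = 1
    · subst h; exact one_dvd _
    · rw [hrow j (by rw [mem_Icc] at *; omega)]
  · intro j hj
    by_cases h : j = 1
    · subst h; exact one_dvd _
    · rw [hcol j (by rw [mem_Icc] at *; omega)]

lemma kg_two (m : ℕ) (hm : 4 ≤ m) :
    ∃ P Q : Finpartition (Finset.univ : Finset (Fin (∑ j ∈ Icc 1 m, j + m))),
      KnowltonGraham P Q := by
  let p : ℕ → ℕ → Prop := fun j k =>
    (j = 1 ∧ k ≠ 3) ∨ (k = 1 ∧ j ≠ 3) ∨ m + 2 ≤ j + k ∨ (j = 2 ∧ k = 2) ∨ (j = 2 ∧ k = 3)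
      ∨ (j = 3 ∧ k = 2)
  have : ∀ a b, Decidable (p a b) := fun a b => by unfold p; infer_instance
  have hsymm : ∀ a b, p a b ↔ p b a := by intro a b; simp only [p]; omega
  have h2 : ((Icc 1 m).filter (fun k => p 2 k)).card = 4 := by
    have : (Icc 1 m).filter (fun k => p 2 k) = insert m (Icc 1 3) := by
      ext k; simp only [mem_filter, mem_insert, mem_Icc, p, true_and]; omega
    rw [this, card_insert_of_notMem (by simp; omega), Nat.card_Icc]
  have h1 : ((Icc 1 m).filter (fun k => p 1 k)).card = m - 1 := by
    have : (Icc 1 m).filter (fun k => p 1 k) = (Icc 1 m).erase 3 := by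
      ext k; simp only [mem_filter, mem_erase, mem_Icc, p, ne_eq, true_and]; omega
    rw [this, card_erase_of_mem (by simp; omega), Nat.card_Icc]; omega
  have hrow : ∀ j ∈ Icc 3 m, ((Icc 1 m).filter (fun k => p j k)).card = j := by
    intro j hj
    rw [mem_Icc] at hj
    by_cases h : j = 3
    · have : (Icc 1 m).filter (fun k => p j k) = insert 2 (Icc (m + 2 - j) m) := by
        ext k; simp only [mem_filter, mem_insert, mem_Icc, p, true_and]; omega
      rw [this, card_insert_of_notMem (by simp; omega), Nat.card_Icc]; omega
    · have : (Icc 1 m).filter (fun k => p j k) = insert 1 (Icc (m + 2 - j) m) := by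
        ext k; simp only [mem_filter, mem_insert, mem_Icc, p, true_and]; omega
      rw [this, card_insert_of_notMem (by simp; omega), Nat.card_Icc]; omega
  have hd : ∀ j ∈ Icc 1 m, j ∣ ((Icc 1 m).filter (fun k => p j k)).card := by
    intro j hj
    rw [mem_Icc] at hj
    by_cases h : j = 1
    · subst h; exact one_dvd _
    by_cases h' : j = 2
    · subst h'; rw [h2]; decide
    · rw [hrow j (by rw [mem_Icc]; omega)]
  refine kg_exists _ m p hd ?_ ?_
  · intro j hj
    have := hd j hj
    simp only [hsymm j] at this
    exact this
  · have : Icc 1 m = insert 1 (insert 2 (Icc 3 m)) := by ext; simp; omega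
    have e : ∀ F : ℕ → ℕ, ∑ j ∈ Icc 1 m, F j = F 1 + (F 2 + ∑ j ∈ Icc 3 m, F j) := by
      intro F
      rw [this, Finset.sum_insert (by simp), Finset.sum_insert (by simp)]
    rw [e, e, h1, h2, Finset.sum_congr rfl hrow]
    omega

lemma kg_dvd {n : ℕ} (P : Finpartition (Finset.univ : Finset (Fin n))) (j : ℕ) :
    j ∣ (univ.filter (fun x => (P.part x).card = j)).card := by
  have : univ.filter (fun x => (P.part x).card = j)
      = (P.parts.filter (fun A => A.card = j)).biUnion id := by
    ext x
    simp only [mem_filter, mem_univ, true_and, mem_biUnion, id]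
    constructor
    · intro h
      exact ⟨P.part x, ⟨P.part_mem.2 (mem_univ x), h⟩, P.mem_part (mem_univ x)⟩
    · rintro ⟨A, ⟨hA, h⟩, hx⟩
      rw [P.part_eq_of_mem hA hx, h]
  rw [this, card_biUnion]
  · refine Finset.dvd_sum ?_
    intro A hA
    rw [mem_filter] at hA
    simp [hA.2]
  · intro A hA B hB hAB
    rw [mem_coe, mem_filter] at hA hB
    exact P.disjoint hA.1 hB.1 hAB

/-- The impossibility argument, when the largest index `m` is a value of `f`. -/
lemma kg_no {n : ℕ} (f g : Fin n → ℕ) (hf : ∀ j, j ∣ (univ.filter (fun x => f x = j)).card)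
    (hg : ∀ j, j ∣ (univ.filter (fun x => g x = j)).card)
    (hinj : ∀ x y, f x = f y → g x = g y → x = y) (x₀ : Fin n)
    (hfm : ∀ x, f x ≤ f x₀) (hgm : ∀ x, g x ≤ f x₀) : n ≠ 2 ∧ n ≠ 5 ∧ n ≠ 9 := by
  set m := f x₀ with hm
  have pos : ∀ (f : Fin n → ℕ), (∀ j, j ∣ (univ.filter (fun x => f x = j)).card) →
      ∀ x, 1 ≤ f x := by
    intro f hf x
    by_contra h
    have h0 : f x = 0 := by omega
    have := hf 0
    rw [zero_dvd_iff, card_eq_zero] at this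
    have hx : x ∈ univ.filter (fun x => f x = 0) := by simp [h0]
    rw [this] at hx
    simp at hx
  have big : ∀ (f : Fin n → ℕ), (∀ j, j ∣ (univ.filter (fun x => f x = j)).card) →
      ∀ x, f x ≤ (univ.filter (fun y => f y = f x)).card := by
    intro f hf x
    exact Nat.le_of_dvd (card_pos.2 ⟨x, by simp⟩) (hf _)
  have hfp := pos f hf
  have hgp := pos g hg
  -- all columns occur
  have himg : (univ.filter (fun y => f y = m)).image g = Icc 1 m := by
    apply Finset.eq_of_subset_of_card_le
    · intro k hk
      rw [mem_image] at hk
      obtain ⟨y, -, rfl⟩ := hk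
      exact mem_Icc.2 ⟨hgp y, hgm y⟩
    · rw [card_image_of_injOn, Nat.card_Icc]
      · simpa using big f hf x₀
      · intro a ha b hb hab
        simp only [coe_filter, mem_univ, true_and, Set.mem_ofPred_eq] at ha hb
        exact hinj a b (ha.trans hb.symm) hab
  have hlow : ∑ j ∈ Icc 1 m, j ≤ n := by
    calc ∑ j ∈ Icc 1 m, j ≤ ∑ j ∈ Icc 1 m, (univ.filter (fun x => g x = j)).card := by
          apply Finset.sum_le_sum
          intro j hj
          rw [← himg, mem_image] at hj
          obtain ⟨y, -, rfl⟩ := hj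
          exact big g hg y
      _ = (univ : Finset (Fin n)).card := by
          rw [← Finset.card_eq_sum_card_fiberwise]
          intro x _
          simpa using ⟨hgp x, hgm x⟩
      _ = n := by simp
  let φ : Fin n → ℕ × ℕ := fun x => (f x, g x)
  have hφ : Function.Injective φ := by
    intro x y h
    simp only [φ, Prod.mk.injEq] at h
    exact hinj x y h.1 h.2
  have hsub : univ.image φ ⊆ Icc 1 m ×ˢ Icc 1 m := by
    intro a ha
    rw [mem_image] at ha
    obtain ⟨x, -, rfl⟩ := ha
    simp only [φ, mem_product, mem_Icc]
    exact ⟨⟨hfp x, hfm x⟩, hgp x, hgm x⟩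
  have hcard : (univ.image φ).card = n := by rw [card_image_of_injective _ hφ]; simp
  have hup : n ≤ m * m := by
    have := card_le_card hsub
    rw [hcard, card_product, Nat.card_Icc] at this
    simpa using this
  have hs := kg_sum m
  have h9 : n = 9 → m ≠ 3 := by
    intro hn hm3
    have heq : univ.image φ = Icc 1 m ×ˢ Icc 1 m := by
      apply Finset.eq_of_subset_of_card_le hsub
      rw [hcard, card_product, Nat.card_Icc, hm3, hn]
    have h2 := hf 2
    have : (univ.filter (fun x => f x = 2)).card
        = ((Icc 1 m ×ˢ Icc 1 m).filter (fun a => a.1 = 2)).card := by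
      rw [← heq, Finset.filter_image, card_image_of_injective _ hφ]
    rw [this, hm3] at h2
    revert h2
    decide
  refine ⟨?_, ?_, ?_⟩
  · intro h
    have : m ≤ 1 ∨ 2 ≤ m := by omega
    rcases this with h' | h' <;> nlinarith
  · intro h
    have : m ≤ 2 ∨ 3 ≤ m := by omega
    rcases this with h' | h' <;> nlinarith
  · intro h
    have : m ≤ 2 ∨ m = 3 ∨ 4 ≤ m := by omega
    rcases this with h' | h' | h'
    · nlinarith
    · exact h9 h h'
    · nlinarith

lemma kg_decomp (n : ℕ) (hn : 0 < n) : ∃ m t, 1 ≤ m ∧ t ≤ m ∧ n = ∑ j ∈ Icc 1 m, j + t := by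
  induction n with
  | zero => omega
  | succ n ih =>
    rcases Nat.eq_zero_or_pos n with h | h
    · subst h; exact ⟨1, 0, by simp⟩
    · obtain ⟨m, t, h1, h2, h3⟩ := ih h
      rcases Nat.lt_or_ge t m with h4 | h4
      · exact ⟨m, t + 1, h1, h4, by omega⟩
      · refine ⟨m + 1, 0, by omega, by omega, ?_⟩
        rw [Finset.sum_Icc_succ_top (by omega)]; omega

theorem stmt6 (n : ℕ) (hn : 0 < n) :
    (∃ P Q : Finpartition (Finset.univ : Finset (Fin n)), KnowltonGraham P Q) ↔
    (n ≠ 2 ∧ n ≠ 5 ∧ n ≠ 9) := by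
  constructor
  · rintro ⟨P, Q, h⟩
    have hinj : ∀ x y, (P.part x).card = (P.part y).card → (Q.part x).card = (Q.part y).card →
        x = y := by
      intro x y h1 h2
      exact h (P.part x).card (Q.part x).card
        ⟨⟨P.part x, P.part_mem.2 (mem_univ x), P.mem_part (mem_univ x), rfl⟩,
          Q.part x, Q.part_mem.2 (mem_univ x), Q.mem_part (mem_univ x), rfl⟩
        ⟨⟨P.part y, P.part_mem.2 (mem_univ y), P.mem_part (mem_univ y), h1.symm⟩,
          Q.part y, Q.part_mem.2 (mem_univ y), Q.mem_part (mem_univ y), h2.symm⟩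
    have hne : (univ : Finset (Fin n)).Nonempty := ⟨⟨0, hn⟩, mem_univ _⟩
    obtain ⟨x, -, hx⟩ := exists_max_image univ (fun x => (P.part x).card) hne
    obtain ⟨y, -, hy⟩ := exists_max_image univ (fun x => (Q.part x).card) hne
    rcases le_total (Q.part y).card (P.part x).card with hxy | hxy
    · exact kg_no _ _ (kg_dvd P) (kg_dvd Q) hinj x (fun z => hx z (mem_univ z))
        (fun z => (hy z (mem_univ z)).trans hxy)
    · exact kg_no _ _ (kg_dvd Q) (kg_dvd P) (fun a b h1 h2 => hinj a b h2 h1) y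
        (fun z => hy z (mem_univ z)) (fun z => (hx z (mem_univ z)).trans hxy)
  · rintro ⟨h2, h5, h9⟩
    obtain ⟨m, t, h1, ht, rfl⟩ := kg_decomp n hn
    rcases Nat.lt_or_ge t m with h | h
    · exact kg_one m t h1 h
    · have : t = m := le_antisymm ht h
      subst this
      rcases Nat.lt_or_ge t 4 with h4 | h4
      · exfalso
        have hs := kg_sum t
        interval_cases t <;> omega
      · exact kg_two t h4
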